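/- Let α be an infinite linearly ordered type, Γ a finite subset of α containing the two distinguished distinct elements 0 and 1, and let Z = {φ ∈ X_Id | φ(0) < φ(1)} ∩ K_Γ and W = {φ ∈ X_Id | φ(0) > φ(1)} ∩ K_Γ. Put S = c_0 c_1 (c_1 Z ∩ s⁰₁ c_1 Z ∩ (d_{01})ᶜ) ∪ c_0(X_Id ∖ c_1 Z) and T = c_0 c_1 (c_1 W ∩ s⁰₁ c_1 W ∩ (d_{01})ᶜ) ∪ c_0(X_Id ∖ c_1 W). Then c_{(Γ)}(S ∩ T) ∩ K_Γ = ∅; in particular the identity map lies in X_Id ∖ c_{(Γ)}(S ∩ T), so X_Id ∖ c_{(Γ)}(S ∩ T) ≠ ∅. -/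

import Mathlib

open Set Function

variable {α : Type*}

/-- Cylindrification on `Γ'` of a set of `α`-sequences over `α`. -/
def cyl (Γ' : Set α) (X : Set (α → α)) : Set (α → α) :=
  {s | ∃ t ∈ X, ∀ j ∉ Γ', t j = s j}

/-- Substitution along `τ` on subsets of `ᵅα`. -/
def sub (τ : α → α) (X : Set (α → α)) : Set (α → α) := {φ | φ ∘ τ ∈ X}

/-- `[0|1]`, sending `e₀` to `e₁` and fixing every other point. -/
noncomputable def repl (e₀ e₁ : α) : α → α :=
  haveI := Classical.decEq α
  fun a => if a = e₀ then e₁ else a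

/-- The diagonal set `d_{01} = {φ | φ(0) = φ(1)}`. -/
def diag (e₀ e₁ : α) : Set (α → α) := {φ | φ e₀ = φ e₁}

/-- `X_Id`: the set of injective maps `α → α`. -/
def XId (α : Type*) : Set (α → α) := {φ | Function.Injective φ}

/-- `K_Γ = c_{(Γ)}{id} = {φ | φ j = j for all j ∉ Γ}`. -/
def KK (Γ : Finset α) : Set (α → α) := cyl (↑Γ) {id}

theorem mem_KK_iff (Γ : Finset α) (f : α → α) : f ∈ KK Γ ↔ ∀ j ∉ Γ, f j = j := by
  constructor
  · rintro ⟨t, ht, h⟩ j hj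
    have ht' : t = id := ht
    subst ht'
    exact (h j (by simpa using hj)).symm
  · intro h
    exact ⟨id, rfl, fun j hj => (h j (by simpa using hj)).symm⟩

theorem surj_of_fix (Γ : Finset α) (f : α → α) (hf : Function.Injective f)
    (h : ∀ j ∉ Γ, f j = j) : Function.Surjective f := by
  intro y
  by_cases hy : y ∈ Γ
  · have hmap : ∀ x ∈ Γ, f x ∈ Γ := by
      intro x hx
      by_contra hc
      have h1 := hf (h _ hc)
      rw [h1] at hc
      exact hc hx
    obtain ⟨x, _, hxy⟩ := Finset.surjOn_of_injOn_of_card_le f hmap hf.injOn le_rfl hy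
    exact ⟨x, hxy⟩
  · exact ⟨y, h y hy⟩

theorem swap_vals (Γ : Finset α) (e₀ e₁ : α) (f g : α → α)
    (hf : Function.Injective f) (hg : Function.Injective g)
    (hfK : ∀ j ∉ Γ, f j = j) (h : ∀ j, j ≠ e₀ → j ≠ e₁ → f j = g j)
    (i : α) (hi : i = e₀ ∨ i = e₁) : g i = f e₀ ∨ g i = f e₁ := by
  obtain ⟨x, hx⟩ := surj_of_fix Γ f hf hfK (g i)
  by_cases h0 : x = e₀
  · subst h0; exact Or.inl hx.symm
  by_cases h1 : x = e₁
  · subst h1; exact Or.inr hx.symm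
  have := hg ((h x h0 h1).symm.trans hx)
  subst this
  tauto

/-- The first part of `S` and `T` is empty, for any strict order relation `r`. -/
theorem first_empty (Γ : Finset α) (e₀ e₁ : α) (h01 : e₀ ≠ e₁) (r : α → α → Prop)
    (htr : ∀ a b, r a b → r b a → False) (Z : Set (α → α))
    (hZ : ∀ z ∈ Z, Function.Injective z ∧ r (z e₀) (z e₁) ∧ ∀ j ∉ Γ, z j = j)
    (u : α → α) (hu : u ∈ cyl {e₁} Z ∩ sub (repl e₀ e₁) (cyl {e₁} Z) ∩ (diag e₀ e₁)ᶜ) :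
    False := by
  obtain ⟨⟨⟨z, hz, hzu⟩, ⟨w, hw, hwu⟩⟩, hd⟩ := hu
  obtain ⟨zi, zr, zk⟩ := hZ z hz
  obtain ⟨wi, wr, wk⟩ := hZ w hw
  have hd : u e₀ ≠ u e₁ := hd
  have a0 : z e₀ = u e₀ := hzu e₀ (by simpa using h01)
  have b0 : w e₀ = u e₁ := by
    have := hwu e₀ (by simpa using h01)
    simpa [repl] using this
  have hzw : ∀ j, j ≠ e₀ → j ≠ e₁ → z j = w j := by
    intro j j0 j1
    have h1 := hzu j (by simpa using j1)
    have h2 := hwu j (by simpa using j1)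
    simp [repl, j0] at h2
    rw [h1, h2]
  have c1 := swap_vals Γ e₀ e₁ z w zi wi zk hzw e₀ (Or.inl rfl)
  have c2 := swap_vals Γ e₀ e₁ w z wi zi wk (fun j a b => (hzw j a b).symm) e₀ (Or.inl rfl)
  have hne : z e₀ ≠ w e₀ := by rw [a0, b0]; exact hd
  have d1 : w e₀ = z e₁ := c1.resolve_left hne.symm
  have d2 : z e₀ = w e₁ := c2.resolve_left hne
  rw [← d1] at zr
  rw [← d2] at wr
  exact htr _ _ zr wr

/-- With `Z, W` as before and
`S = c_0 c_1 (c_1 Z ∩ s⁰₁ c_1 Z ∩ (d_{01})ᶜ) ∪ c_0(X_Id ∖ c_1 Z)`,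
`T = c_0 c_1 (c_1 W ∩ s⁰₁ c_1 W ∩ (d_{01})ᶜ) ∪ c_0(X_Id ∖ c_1 W)`, we have
`c_{(Γ)}(S ∩ T) ∩ K_Γ = ∅`; in particular `id ∈ X_Id ∖ c_{(Γ)}(S ∩ T)`, so the latter set
is nonempty. -/
theorem cyl_S_inter_T_empty [LinearOrder α] [Infinite α] (Γ : Finset α) (e₀ e₁ : α)
    (h01 : e₀ ≠ e₁) (h₀ : e₀ ∈ Γ) (h₁ : e₁ ∈ Γ) :
    let Z : Set (α → α) := {φ ∈ XId α | φ e₀ < φ e₁} ∩ KK Γ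
    let W : Set (α → α) := {φ ∈ XId α | φ e₁ < φ e₀} ∩ KK Γ
    let S : Set (α → α) :=
      cyl {e₀} (cyl {e₁} (cyl {e₁} Z ∩ sub (repl e₀ e₁) (cyl {e₁} Z) ∩ (diag e₀ e₁)ᶜ)) ∪
        cyl {e₀} (XId α \ cyl {e₁} Z)
    let T : Set (α → α) :=
      cyl {e₀} (cyl {e₁} (cyl {e₁} W ∩ sub (repl e₀ e₁) (cyl {e₁} W) ∩ (diag e₀ e₁)ᶜ)) ∪
        cyl {e₀} (XId α \ cyl {e₁} W)
    cyl (↑Γ) (S ∩ T) ∩ KK Γ = ∅ ∧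
      id ∈ XId α \ cyl (↑Γ) (S ∩ T) ∧
      (XId α \ cyl (↑Γ) (S ∩ T)).Nonempty := by
  intro Z W S T
  have key : ∀ s ∈ S ∩ T, s ∈ KK Γ → False := by
    rintro s ⟨hS, hT⟩ hK
    rw [mem_KK_iff] at hK
    rcases hS with ⟨t, ⟨u, hu, _⟩, _⟩ | ⟨u, ⟨hui, huZ⟩, hus⟩
    · exact first_empty Γ e₀ e₁ h01 (· < ·) (fun a b h h' => lt_asymm h h') Z
        (fun z hz => ⟨hz.1.1, hz.1.2, (mem_KK_iff _ _).1 hz.2⟩) u hu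
    rcases hT with ⟨t, ⟨v, hv, _⟩, _⟩ | ⟨v, ⟨hvi, hvW⟩, hvs⟩
    · exact first_empty Γ e₀ e₁ h01 (· > ·) (fun a b h h' => lt_asymm h h') W
        (fun z hz => ⟨hz.1.1, hz.1.2, (mem_KK_iff _ _).1 hz.2⟩) v hv
    have hui : Function.Injective u := hui
    have hvi : Function.Injective v := hvi
    have uv : ∀ j, j ≠ e₀ → u j = v j := fun j hj => (hus j hj).trans (hvs j hj).symm
    have uK : ∀ j ∉ Γ, u j = j := fun j hj =>
      (hus j (fun h => hj (by rw [show j = e₀ from h]; exact h₀))).trans (hK j hj)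
    have vu0 : v e₀ = u e₀ := by
      rcases swap_vals Γ e₀ e₁ u v hui hvi uK (fun j a _ => uv j a) e₀ (Or.inl rfl) with h | h
      · exact h
      · rw [uv e₁ h01.symm] at h
        exact absurd (hvi h) h01
    have huv : u = v := by
      funext j
      by_cases hj : j = e₀
      · rw [hj, vu0]
      · exact uv j hj
    subst huv
    rcases lt_trichotomy (u e₀) (u e₁) with h | h | h
    · exact huZ ⟨u, ⟨⟨hui, h⟩, (mem_KK_iff _ _).2 uK⟩, fun _ _ => rfl⟩
    · exact h01 (hui h)
    · exact hvW ⟨u, ⟨⟨hui, h⟩, (mem_KK_iff _ _).2 uK⟩, fun _ _ => rfl⟩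
  have hE : cyl (↑Γ) (S ∩ T) ∩ KK Γ = ∅ := by
    rw [Set.eq_empty_iff_forall_notMem]
    rintro s ⟨⟨t, ht, hts⟩, hs⟩
    rw [mem_KK_iff] at hs
    exact key t ht ((mem_KK_iff _ _).2
      (fun j hj => (hts j (by simpa using hj)).trans (hs j hj)))
  have hid : id ∈ XId α \ cyl (↑Γ) (S ∩ T) := by
    refine ⟨Function.injective_id, fun h => ?_⟩
    have : id ∈ cyl (↑Γ) (S ∩ T) ∩ KK Γ := ⟨h, (mem_KK_iff _ _).2 (fun _ _ => rfl)⟩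
    rw [hE] at this
    exact this
  exact ⟨hE, hid, ⟨id, hid⟩⟩
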